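/- arXiv:2603.08037 — 9 statements merged into one kernel-verified Lean document; each statement's English description precedes it below -/
import Mathlib

section
/- Let 0 ≤ i < n and let M₁ and M₂ be partial embeddings of Q_i such that M₁(u) = M₂(u) for every backward neighbor u ∈ N₋(u_i). Let v ∈ V(G) be a data vertex that lies neither in the image of M₁ nor in the image of M₂. If M₁ ⊕ v is a partial embedding of Q_{i+1}, then M₂ ⊕ v is also a partial embedding of Q_{i+1}. -/
/-!
Common setup: `Q : SimpleGraph α` is the query graph, `G : SimpleGraph β` is the
data graph, `LQ`/`LG` are vertex labelings into a label type `σ`, and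
`u : Fin n → α` is the matching order `O = (u_0, …, u_{n-1})` (a bijective
enumeration of the query vertices).  A partial embedding of `Q_i` is modeled as
a function `M : Fin n → β` whose behaviour only matters on indices `< i`.
-/

namespace CEMR

variable {α β σ : Type*} {n : ℕ}

/-- `M` is a partial embedding of the subquery `Q_i` induced by the first `i`
vertices of the matching order `u`: it is injective on the prefix, preserves
labels on the prefix, and preserves adjacency on the prefix. -/
def PartialEmb (Q : SimpleGraph α) (G : SimpleGraph β) (LQ : α → σ) (LG : β → σ)
    (u : Fin n → α) (i : ℕ) (M : Fin n → β) : Prop :=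
  (∀ j k : Fin n, j.val < i → k.val < i → M j = M k → j = k) ∧
  (∀ j : Fin n, j.val < i → LG (M j) = LQ (u j)) ∧
  (∀ j k : Fin n, j.val < i → k.val < i → Q.Adj (u j) (u k) → G.Adj (M j) (M k))

/-- `F` is a full embedding of `Q` in `G`. -/
def FullEmb (Q : SimpleGraph α) (G : SimpleGraph β) (LQ : α → σ) (LG : β → σ)
    (F : α → β) : Prop :=
  Function.Injective F ∧ (∀ a, LG (F a) = LQ a) ∧
    ∀ a b, Q.Adj a b → G.Adj (F a) (F b)

/-- The extensible set `R_M(u_i)`: data vertices with the right label that are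
adjacent to the images of all backward neighbors of `u_i`. -/
def RSet (Q : SimpleGraph α) (G : SimpleGraph β) (LQ : α → σ) (LG : β → σ)
    (u : Fin n → α) (i : Fin n) (M : Fin n → β) : Set β :=
  {v | LG v = LQ (u i) ∧
    ∀ j : Fin n, j.val < i.val → Q.Adj (u j) (u i) → G.Adj (M j) v}

/-- Lemma 3.1, redundancy lemma.  If two partial embeddings
`M₁, M₂` of `Q_i` agree on every backward neighbor of `u_i`, and `v` lies in
the image of neither, then whenever `M₁ ⊕ v` is a partial embedding of
`Q_{i+1}`, so is `M₂ ⊕ v`. -/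
theorem redundancy_lemma (Q : SimpleGraph α) (G : SimpleGraph β)
    (LQ : α → σ) (LG : β → σ)
    (u : Fin n → α) (hu : Function.Bijective u) (i : Fin n)
    (M₁ M₂ : Fin n → β)
    (h₁ : PartialEmb Q G LQ LG u i.val M₁)
    (h₂ : PartialEmb Q G LQ LG u i.val M₂)
    (hagree : ∀ j : Fin n, j.val < i.val → Q.Adj (u j) (u i) → M₁ j = M₂ j)
    (v : β)
    (hv₁ : ∀ j : Fin n, j.val < i.val → M₁ j ≠ v)
    (hv₂ : ∀ j : Fin n, j.val < i.val → M₂ j ≠ v)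
    (hext : PartialEmb Q G LQ LG u (i.val + 1) (Function.update M₁ i v)) :
    PartialEmb Q G LQ LG u (i.val + 1) (Function.update M₂ i v) := by
  obtain ⟨inj, lab, adj⟩ := h₂
  obtain ⟨-, lab', adj'⟩ := hext
  have hlt : ∀ j : Fin n, j.val < i.val + 1 → j ≠ i → j.val < i.val := by
    intro j hj hne
    have := Fin.val_ne_of_ne hne
    omega
  have hlab : LG v = LQ (u i) := by simpa using lab' i (Nat.lt_succ_self _)
  have hadj : ∀ j : Fin n, j.val < i.val → Q.Adj (u j) (u i) → G.Adj (M₂ j) v := by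
    intro j hj hQ
    have hne : j ≠ i := Fin.ne_of_lt hj
    have := adj' j i (by omega) (by omega) hQ
    rwa [Function.update_self, Function.update_of_ne hne, hagree j hj hQ] at this
  refine ⟨fun j k hj hk h => ?_, fun j hj => ?_, fun j k hj hk h => ?_⟩
  · rcases eq_or_ne j i with rfl | hji <;> rcases eq_or_ne k j with rfl | hkj
    · rfl
    · rw [Function.update_self, Function.update_of_ne hkj] at h
      exact absurd h.symm (hv₂ k (hlt k hk hkj))
    · rfl
    · rw [Function.update_of_ne hji] at h
      rcases eq_or_ne k i with rfl | hki
      · rw [Function.update_self] at h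
        exact absurd h (hv₂ j (hlt j hj hji))
      · rw [Function.update_of_ne hki] at h
        exact inj j k (hlt j hj hji) (hlt k hk hki) h
  · rcases eq_or_ne j i with rfl | hji
    · rwa [Function.update_self]
    · rw [Function.update_of_ne hji]
      exact lab j (hlt j hj hji)
  · rcases eq_or_ne j i with rfl | hji
    · have hkj : k ≠ j := fun hkj => h.ne (congrArg u hkj.symm)
      rw [Function.update_self, Function.update_of_ne hkj]
      exact (hadj k (hlt k hk hkj) h.symm).symm
    · rw [Function.update_of_ne hji]
      rcases eq_or_ne k i with rfl | hki
      · rw [Function.update_self]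
        exact hadj j (hlt j hj hji) h
      · rw [Function.update_of_ne hki]
        exact adj j k (hlt j hj hji) (hlt k hk hki) h

end CEMR
end

section
/- Let 0 ≤ i < n, let M be a partial embedding of Q_i, and let M* be a full embedding of Q in G extending M. Then M*(u_i) ∈ R_M(u_i), and moreover M*(u_j) ∈ R_M(u_i) for every vertex u_j ∈ Con(u_i). -/
/-!
Common setup: `Q : SimpleGraph α` is the query graph, `G : SimpleGraph β` is the
data graph, `LQ`/`LG` are vertex labelings into a label type `σ`, and
`u : Fin n → α` is the matching order `O = (u_0, …, u_{n-1})` (a bijective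
enumeration of the query vertices).  A partial embedding of `Q_i` is modeled as
a function `M : Fin n → β` whose behaviour only matters on indices `< i`.
-/

namespace CEMR

variable {α β σ : Type*} {n : ℕ}

/-- `u_j` is contained by `u_i` (under the matching order `u`): `i < j`, the
labels agree, and every backward neighbor of `u_i` is a backward neighbor of
`u_j`. -/
def ConIdx (Q : SimpleGraph α) (LQ : α → σ) (u : Fin n → α) (i j : Fin n) : Prop :=
  i < j ∧ LQ (u j) = LQ (u i) ∧
    ∀ k : Fin n, k.val < i.val → Q.Adj (u k) (u i) → Q.Adj (u k) (u j)

/-- If `M*` is a full embedding extending the partial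
embedding `M` of `Q_i`, then `M*(u_i) ∈ R_M(u_i)`, and moreover
`M*(u_j) ∈ R_M(u_i)` for every `u_j ∈ Con(u_i)`. -/
theorem full_embedding_into_extensible (Q : SimpleGraph α) (G : SimpleGraph β)
    (LQ : α → σ) (LG : β → σ)
    (u : Fin n → α) (hu : Function.Bijective u) (i : Fin n)
    (M : Fin n → β)
    (hM : PartialEmb Q G LQ LG u i.val M)
    (F : α → β)
    (hF : FullEmb Q G LQ LG F)
    (hext : ∀ j : Fin n, j.val < i.val → F (u j) = M j) :
    F (u i) ∈ RSet Q G LQ LG u i M ∧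
      ∀ j : Fin n, ConIdx Q LQ u i j → F (u j) ∈ RSet Q G LQ LG u i M := by
  have mem_of_backward_adj : ∀ a : α, LQ a = LQ (u i) →
      (∀ k : Fin n, k.val < i.val → Q.Adj (u k) (u i) → Q.Adj (u k) a) →
      F a ∈ RSet Q G LQ LG u i M := fun a hlabel hadj =>
    ⟨(hF.2.1 a).trans hlabel, fun k hk hki => hext k hk ▸ hF.2.2 _ _ (hadj k hk hki)⟩
  exact ⟨mem_of_backward_adj _ rfl fun _ _ h => h,
    fun j hj => mem_of_backward_adj _ hj.2.1 hj.2.2⟩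

end CEMR
end

section
/- Let 0 ≤ i < n, let M be a partial embedding of Q_i, and let M* be a full embedding of Q in G extending M. Then the restriction of M* to Con(u_i) is an injective map whose image is contained in R_M(u_i); in particular, |R_M(u_i)| ≥ |Con(u_i)|. -/
/-!
Common setup: `Q : SimpleGraph α` is the query graph, `G : SimpleGraph β` is the
data graph, `LQ`/`LG` are vertex labelings into a label type `σ`, and
`u : Fin n → α` is the matching order `O = (u_0, …, u_{n-1})` (a bijective
enumeration of the query vertices).  A partial embedding of `Q_i` is modeled as
a function `M : Fin n → β` whose behaviour only matters on indices `< i`.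
-/

namespace CEMR

variable {α β σ : Type*} {n : ℕ}

/-- If `M*` is a full embedding extending the partial
embedding `M` of `Q_i`, then `M*` restricted to `Con(u_i)` is injective with
image contained in `R_M(u_i)`; in particular `|R_M(u_i)| ≥ |Con(u_i)|`. -/
theorem con_injects_into_extensible [Fintype β] (Q : SimpleGraph α)
    (G : SimpleGraph β) (LQ : α → σ) (LG : β → σ)
    (u : Fin n → α) (hu : Function.Bijective u) (i : Fin n)
    (M : Fin n → β)
    (hM : PartialEmb Q G LQ LG u i.val M)
    (F : α → β)
    (hF : FullEmb Q G LQ LG F)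
    (hext : ∀ j : Fin n, j.val < i.val → F (u j) = M j) :
    Set.InjOn (fun j : Fin n => F (u j)) {j | ConIdx Q LQ u i j} ∧
      (∀ j : Fin n, ConIdx Q LQ u i j → F (u j) ∈ RSet Q G LQ LG u i M) ∧
      {j : Fin n | ConIdx Q LQ u i j}.ncard ≤ (RSet Q G LQ LG u i M).ncard := by
  have hinj : Set.InjOn (fun j : Fin n => F (u j)) {j | ConIdx Q LQ u i j} :=
    (hF.1.comp hu.1).injOn
  have hmem : ∀ j : Fin n, ConIdx Q LQ u i j → F (u j) ∈ RSet Q G LQ LG u i M := by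
    rintro j ⟨-, hlabel, hback⟩
    refine ⟨(hF.2.1 (u j)).trans hlabel, fun k hk hadj => ?_⟩
    rw [← hext k hk]
    exact hF.2.2 _ _ (hback k hk hadj)
  exact ⟨hinj, hmem, Set.ncard_le_ncard_of_injOn _ hmem hinj (Set.toFinite _)⟩

end CEMR
end

section
/- (Contained vertex pruning) Let 0 ≤ i < n and let M be a partial embedding of Q_i. If |R_M(u_i)| < |Con(u_i)|, then no full embedding of Q in G extends M. -/
/-!
Common setup: `Q : SimpleGraph α` is the query graph, `G : SimpleGraph β` is the
data graph, `LQ`/`LG` are vertex labelings into a label type `σ`, and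
`u : Fin n → α` is the matching order `O = (u_0, …, u_{n-1})` (a bijective
enumeration of the query vertices).  A partial embedding of `Q_i` is modeled as
a function `M : Fin n → β` whose behaviour only matters on indices `< i`.
-/

namespace CEMR

variable {α β σ : Type*} {n : ℕ}

/-- contained vertex pruning.  If `M` is a partial embedding
of `Q_i` with `|R_M(u_i)| < |Con(u_i)|`, then no full embedding of `Q` in `G`
extends `M`. -/
theorem contained_vertex_pruning [Fintype β] (Q : SimpleGraph α)
    (G : SimpleGraph β) (LQ : α → σ) (LG : β → σ)
    (u : Fin n → α) (hu : Function.Bijective u) (i : Fin n)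
    (M : Fin n → β)
    (hM : PartialEmb Q G LQ LG u i.val M)
    (hcard : (RSet Q G LQ LG u i M).ncard < {j : Fin n | ConIdx Q LQ u i j}.ncard) :
    ¬ ∃ F : α → β, FullEmb Q G LQ LG F ∧
        ∀ j : Fin n, j.val < i.val → F (u j) = M j := by
  rintro ⟨F, ⟨hinj, hlab, hadj⟩, hext⟩
  refine hcard.not_ge (Set.ncard_le_ncard_of_injOn (F ∘ u) ?_
    (hinj.comp hu.injective).injOn (Set.toFinite _))
  rintro j ⟨-, hl, hN⟩
  refine ⟨(hlab (u j)).trans hl, fun k hk hki => ?_⟩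
  rw [← hext k hk]
  exact hadj _ _ (hN k hk hki)

end CEMR
end

section
/- (Extended failing set, insufficient candidate class) Let 0 ≤ i < n and let M be a partial embedding of Q_i with |R_M(u_i)| < |Con(u_i)|. Then Anc(u_i) is a failing set of M; that is, no full embedding of Q in G agrees with M on every vertex of Anc(u_i). -/
/-!
Common setup: `Q : SimpleGraph α` is the query graph, `G : SimpleGraph β` is the
data graph, `LQ`/`LG` are vertex labelings into a label type `σ`, and
`u : Fin n → α` is the matching order `O = (u_0, …, u_{n-1})` (a bijective
enumeration of the query vertices).  A partial embedding of `Q_i` is modeled as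
a function `M : Fin n → β` whose behaviour only matters on indices `< i`.
-/

namespace CEMR

variable {α β σ : Type*} {n : ℕ}

/-- `F` is a failing set of the partial embedding `M` of `Q_m`: no full
embedding of `Q` in `G` agrees with `M` on every vertex of
`F ∩ {u_0, …, u_{m-1}}`. -/
def FailingSet (Q : SimpleGraph α) (G : SimpleGraph β) (LQ : α → σ) (LG : β → σ)
    (u : Fin n → α) (m : ℕ) (M : Fin n → β) (F : Set α) : Prop :=
  ¬ ∃ Fm : α → β, FullEmb Q G LQ LG Fm ∧
      ∀ j : Fin n, j.val < m → u j ∈ F → Fm (u j) = M j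

/-- `Anc(u_i)` as a set of indices: the smallest subset of `{u_0, …, u_{i-1}}`
containing the backward neighbors of `u_i` and closed under backward
neighbors. -/
inductive AncIdx (Q : SimpleGraph α) (u : Fin n → α) (i : Fin n) : Fin n → Prop
  | base (j : Fin n) : j.val < i.val → Q.Adj (u j) (u i) → AncIdx Q u i j
  | step (j k : Fin n) : AncIdx Q u i k → j.val < k.val → Q.Adj (u j) (u k) →
      AncIdx Q u i j

/-- extended failing set, insufficient candidate class.  If
`M` is a partial embedding of `Q_i` with `|R_M(u_i)| < |Con(u_i)|`, then
`Anc(u_i)` is a failing set of `M`. -/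
theorem insufficient_candidate_failing_set [Fintype β] (Q : SimpleGraph α)
    (G : SimpleGraph β) (LQ : α → σ) (LG : β → σ)
    (u : Fin n → α) (hu : Function.Bijective u) (i : Fin n)
    (M : Fin n → β)
    (hM : PartialEmb Q G LQ LG u i.val M)
    (hcard : (RSet Q G LQ LG u i M).ncard < {j : Fin n | ConIdx Q LQ u i j}.ncard) :
    FailingSet Q G LQ LG u i.val M (u '' {j : Fin n | AncIdx Q u i j}) := by
  rintro ⟨F, ⟨hinj, hlab, hadj⟩, hagree⟩
  refine hcard.not_ge (Set.ncard_le_ncard_of_injOn (fun j => F (u j)) ?_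
    (hinj.comp hu.injective).injOn (Set.toFinite _))
  rintro j ⟨-, hl, hN⟩
  refine ⟨(hlab _).trans hl, fun k hk hadjk => ?_⟩
  rw [← hagree k hk ⟨k, .base k hk hadjk, rfl⟩]
  exact hadj _ _ (hN k hk hadjk)

end CEMR
end

section
/- (Failing set union rule) Let 0 ≤ i < n and let M be a partial embedding of Q_i. Suppose that for every v ∈ R_M(u_i) not lying in the image of M, a set F_v ⊆ V(Q) is a failing set of the partial embedding M ⊕ v of Q_{i+1}. Let K = {u_k : k < i and M(u_k) ∈ R_M(u_i)}. Then the set F = N₋(u_i) ∪ K ∪ ⋃_v (F_v \ {u_i}), where the union ranges over all v ∈ R_M(u_i) not in the image of M, is a failing set of M. -/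
/-!
Common setup: `Q : SimpleGraph α` is the query graph, `G : SimpleGraph β` is the
data graph, `LQ`/`LG` are vertex labelings into a label type `σ`, and
`u : Fin n → α` is the matching order `O = (u_0, …, u_{n-1})` (a bijective
enumeration of the query vertices).  A partial embedding of `Q_i` is modeled as
a function `M : Fin n → β` whose behaviour only matters on indices `< i`.
-/

namespace CEMR

variable {α β σ : Type*} {n : ℕ}

/-- failing set union rule.  Suppose that for every vertex
`v ∈ R_M(u_i)` not in the image of `M`, the set `Fv v` is a failing set of
`M ⊕ v`.  Let `K = {u_k : k < i, M(u_k) ∈ R_M(u_i)}`.  Then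
`N₋(u_i) ∪ K ∪ ⋃_v (Fv v \ {u_i})` is a failing set of `M`. -/
theorem failing_set_union_rule (Q : SimpleGraph α) (G : SimpleGraph β)
    (LQ : α → σ) (LG : β → σ)
    (u : Fin n → α) (hu : Function.Bijective u) (i : Fin n)
    (M : Fin n → β)
    (hM : PartialEmb Q G LQ LG u i.val M)
    (Fv : β → Set α)
    (hFv : ∀ v ∈ RSet Q G LQ LG u i M, (∀ j : Fin n, j.val < i.val → M j ≠ v) →
      FailingSet Q G LQ LG u (i.val + 1) (Function.update M i v) (Fv v)) :
    FailingSet Q G LQ LG u i.val M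
      ((u '' {j : Fin n | j.val < i.val ∧ Q.Adj (u j) (u i)}) ∪
        (u '' {k : Fin n | k.val < i.val ∧ M k ∈ RSet Q G LQ LG u i M}) ∪
        (⋃ v ∈ {v : β | v ∈ RSet Q G LQ LG u i M ∧
            ∀ j : Fin n, j.val < i.val → M j ≠ v},
          Fv v \ {u i})) := by
  rintro ⟨Fm, hFm, hag⟩
  have hR : Fm (u i) ∈ RSet Q G LQ LG u i M := by
    refine ⟨hFm.2.1 _, fun j hj hadj => ?_⟩
    rw [← hag j hj (Or.inl (Or.inl ⟨j, ⟨hj, hadj⟩, rfl⟩))]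
    exact hFm.2.2 _ _ hadj
  have hnot : ∀ j : Fin n, j.val < i.val → M j ≠ Fm (u i) := by
    intro j hj hjv
    have hK := hag j hj (Or.inl (Or.inr ⟨j, ⟨hj, hjv ▸ hR⟩, rfl⟩))
    have hji : j = i := hu.1 (hFm.1 (hK.trans hjv))
    exact hj.ne (congrArg Fin.val hji)
  refine hFv _ hR hnot ⟨Fm, hFm, fun j hj hjF => ?_⟩
  rcases eq_or_ne j i with rfl | hji
  · rw [Function.update_self]
  · rw [Function.update_of_ne hji]
    refine hag j ?_ (Or.inr (Set.mem_biUnion (x := Fm (u i)) ⟨hR, hnot⟩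
      ⟨hjF, fun h => hji (hu.1 h)⟩))
    exact lt_of_le_of_ne (Nat.lt_succ_iff.mp hj) (Fin.val_ne_of_ne hji)

end CEMR
end

section
/- (Emptyset class) Let 0 ≤ i < n and let M be a partial embedding of Q_i with R_M(u_i) = ∅. Then N₋(u_i) is a failing set of M; in particular, no full embedding of Q in G extends M. -/
/-!
Common setup: `Q : SimpleGraph α` is the query graph, `G : SimpleGraph β` is the
data graph, `LQ`/`LG` are vertex labelings into a label type `σ`, and
`u : Fin n → α` is the matching order `O = (u_0, …, u_{n-1})` (a bijective
enumeration of the query vertices).  A partial embedding of `Q_i` is modeled as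
a function `M : Fin n → β` whose behaviour only matters on indices `< i`.
-/

namespace CEMR

variable {α β σ : Type*} {n : ℕ}

/-- A full embedding agreeing with `M` on the backward neighbors of `u i` sends `u i` into the
extensible set. -/
theorem FullEmb.apply_mem_RSet {Q : SimpleGraph α} {G : SimpleGraph β} {LQ : α → σ} {LG : β → σ}
    {u : Fin n → α} {i : Fin n} {M : Fin n → β} {F : α → β} (hF : FullEmb Q G LQ LG F)
    (hag : ∀ j : Fin n, j.val < i.val → Q.Adj (u j) (u i) → F (u j) = M j) :
    F (u i) ∈ RSet Q G LQ LG u i M :=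
  ⟨hF.2.1 _, fun j hj hadj => hag j hj hadj ▸ hF.2.2 _ _ hadj⟩

/-- emptyset class.  If `M` is a partial embedding of `Q_i`
with `R_M(u_i) = ∅`, then the backward-neighbor set `N₋(u_i)` is a failing set
of `M`; in particular, no full embedding of `Q` in `G` extends `M`. -/
theorem emptyset_class_failing_set (Q : SimpleGraph α) (G : SimpleGraph β)
    (LQ : α → σ) (LG : β → σ)
    (u : Fin n → α) (hu : Function.Bijective u) (i : Fin n)
    (M : Fin n → β)
    (hM : PartialEmb Q G LQ LG u i.val M)
    (hR : RSet Q G LQ LG u i M = ∅) :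
    FailingSet Q G LQ LG u i.val M
        (u '' {j : Fin n | j.val < i.val ∧ Q.Adj (u j) (u i)}) ∧
      ¬ ∃ F : α → β, FullEmb Q G LQ LG F ∧
          ∀ j : Fin n, j.val < i.val → F (u j) = M j := by
  constructor
  · rintro ⟨F, hF, hag⟩
    exact hR.le (hF.apply_mem_RSet fun j hj hadj => hag j hj ⟨j, ⟨hj, hadj⟩, rfl⟩)
  · rintro ⟨F, hF, hag⟩
    exact hR.le (hF.apply_mem_RSet fun j hj _ => hag j hj)

end CEMR
end

section
/- (Contained vertex pruning for directed graphs) Let 0 ≤ i < n and let M be a partial embedding of Q_i. If |R_M(u_i)| < |Con(u_i)|, then no full embedding of Q in G extends M. -/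
/-!
Common setup for directed graphs: the query graph is given by an edge relation
`EQ : α → α → Prop` and the data graph by `EG : β → β → Prop`, with vertex
labelings `LQ`/`LG` into a label type `σ`, and a matching order
`u : Fin n → α` (a bijective enumeration of the query vertices).
-/

namespace CEMRDir

variable {α β σ : Type*} {n : ℕ}

/-- `M` is a partial embedding of the directed subquery `Q_i` induced by the
first `i` vertices of the matching order `u`. -/
def DPartialEmb (EQ : α → α → Prop) (EG : β → β → Prop) (LQ : α → σ) (LG : β → σ)
    (u : Fin n → α) (i : ℕ) (M : Fin n → β) : Prop :=
  (∀ j k : Fin n, j.val < i → k.val < i → M j = M k → j = k) ∧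
  (∀ j : Fin n, j.val < i → LG (M j) = LQ (u j)) ∧
  (∀ j k : Fin n, j.val < i → k.val < i → EQ (u j) (u k) → EG (M j) (M k))

/-- `F` is a full embedding of the directed query graph in the data graph. -/
def DFullEmb (EQ : α → α → Prop) (EG : β → β → Prop) (LQ : α → σ) (LG : β → σ)
    (F : α → β) : Prop :=
  Function.Injective F ∧ (∀ a, LG (F a) = LQ a) ∧
    ∀ a b, EQ a b → EG (F a) (F b)

/-- The extensible set `R_M(u_i)` for directed graphs: data vertices with the
right label, respecting the edges from the images of in-backward neighbors of
`u_i` and to the images of out-backward neighbors of `u_i`. -/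
def DRSet (EQ : α → α → Prop) (EG : β → β → Prop) (LQ : α → σ) (LG : β → σ)
    (u : Fin n → α) (i : Fin n) (M : Fin n → β) : Set β :=
  {v | LG v = LQ (u i) ∧
    (∀ j : Fin n, j.val < i.val → EQ (u j) (u i) → EG (M j) v) ∧
    (∀ j : Fin n, j.val < i.val → EQ (u i) (u j) → EG v (M j))}

/-- `u_j` is contained by `u_i` in the directed setting: `i < j`, labels agree,
and both the in- and out-backward neighbors of `u_i` are contained in those of
`u_j`. -/
def DConIdx (EQ : α → α → Prop) (LQ : α → σ) (u : Fin n → α) (i j : Fin n) : Prop :=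
  i < j ∧ LQ (u j) = LQ (u i) ∧
    (∀ k : Fin n, k.val < i.val → EQ (u k) (u i) → EQ (u k) (u j)) ∧
    (∀ k : Fin n, k.val < i.val → EQ (u i) (u k) → EQ (u j) (u k))

/-- contained vertex pruning for directed graphs.  If `M` is
a partial embedding of `Q_i` with `|R_M(u_i)| < |Con(u_i)|`, then no full
embedding of `Q` in `G` extends `M`. -/
theorem directed_contained_vertex_pruning [Fintype β]
    (EQ : α → α → Prop) (EG : β → β → Prop) (LQ : α → σ) (LG : β → σ)
    (u : Fin n → α) (hu : Function.Bijective u) (i : Fin n)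
    (M : Fin n → β)
    (hM : DPartialEmb EQ EG LQ LG u i.val M)
    (hcard : (DRSet EQ EG LQ LG u i M).ncard <
      {j : Fin n | DConIdx EQ LQ u i j}.ncard) :
    ¬ ∃ F : α → β, DFullEmb EQ EG LQ LG F ∧
        ∀ j : Fin n, j.val < i.val → F (u j) = M j := by
  rintro ⟨F, ⟨hinj, hlab, hedge⟩, hext⟩
  refine hcard.not_ge (Set.ncard_le_ncard_of_injOn (F ∘ u) ?_
    (hinj.comp hu.injective).injOn (Set.toFinite _))
  rintro j ⟨-, hL, hin, hout⟩
  refine ⟨(hlab _).trans hL, fun k hk hE => ?_, fun k hk hE => ?_⟩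
  · rw [← hext k hk]
    exact hedge _ _ (hin k hk hE)
  · rw [← hext k hk]
    exact hedge _ _ (hout k hk hE)

end CEMRDir
end

section
/- (Redundancy lemma for directed graphs) Let 0 ≤ i < n and let M₁ and M₂ be partial embeddings of Q_i such that M₁(u) = M₂(u) for every u ∈ N₋ⁱⁿ(u_i) ∪ N₋ᵒᵘᵗ(u_i). Let v ∈ V(G) lie neither in the image of M₁ nor in the image of M₂. If M₁ ⊕ v is a partial embedding of Q_{i+1}, then M₂ ⊕ v is also a partial embedding of Q_{i+1}. -/
/-!
Common setup for directed graphs: the query graph is given by an edge relation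
`EQ : α → α → Prop` and the data graph by `EG : β → β → Prop`, with vertex
labelings `LQ`/`LG` into a label type `σ`, and a matching order
`u : Fin n → α` (a bijective enumeration of the query vertices).
-/

namespace CEMRDir

variable {α β σ : Type*} {n : ℕ}

/-- redundancy lemma for directed graphs.  If two partial
embeddings `M₁, M₂` of `Q_i` agree on every in- and out-backward neighbor of
`u_i`, and `v` lies in the image of neither, then whenever `M₁ ⊕ v` is a
partial embedding of `Q_{i+1}`, so is `M₂ ⊕ v`. -/
theorem directed_redundancy_lemma (EQ : α → α → Prop) (EG : β → β → Prop)
    (LQ : α → σ) (LG : β → σ)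
    (u : Fin n → α) (hu : Function.Bijective u) (i : Fin n)
    (M₁ M₂ : Fin n → β)
    (h₁ : DPartialEmb EQ EG LQ LG u i.val M₁)
    (h₂ : DPartialEmb EQ EG LQ LG u i.val M₂)
    (hagree : ∀ j : Fin n, j.val < i.val →
      (EQ (u j) (u i) ∨ EQ (u i) (u j)) → M₁ j = M₂ j)
    (v : β)
    (hv₁ : ∀ j : Fin n, j.val < i.val → M₁ j ≠ v)
    (hv₂ : ∀ j : Fin n, j.val < i.val → M₂ j ≠ v)
    (hext : DPartialEmb EQ EG LQ LG u (i.val + 1) (Function.update M₁ i v)) :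
    DPartialEmb EQ EG LQ LG u (i.val + 1) (Function.update M₂ i v) := by
  obtain ⟨inj₂, lab₂, edge₂⟩ := h₂
  obtain ⟨-, lab, edge⟩ := hext
  have lt_or_eq (j : Fin n) (hj : j.val < i.val + 1) : j.val < i.val ∨ j = i := by
    rw [Fin.ext_iff]
    omega
  have old (M : Fin n → β) (j : Fin n) (hj : j.val < i.val) :
      Function.update M i v j = M j :=
    Function.update_of_ne (Fin.ne_of_lt hj) v M
  have new (M : Fin n → β) : Function.update M i v i = v := Function.update_self i v M
  refine ⟨fun j k hj hk hjk => ?_, fun j hj => ?_, fun j k hj hk hjk => ?_⟩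
  · rcases lt_or_eq j hj with hj' | rfl <;> rcases lt_or_eq k hk with hk' | rfl
    · rw [old _ _ hj', old _ _ hk'] at hjk
      exact inj₂ j k hj' hk' hjk
    · rw [old _ _ hj', new] at hjk
      exact absurd hjk (hv₂ j hj')
    · rw [old _ _ hk', new] at hjk
      exact absurd hjk.symm (hv₂ k hk')
    · rfl
  · rcases lt_or_eq j hj with hj' | rfl
    · rw [old _ _ hj']
      exact lab₂ j hj'
    · simpa only [new] using lab j hj
  · have h := edge j k hj hk hjk
    rcases lt_or_eq j hj with hj' | rfl <;> rcases lt_or_eq k hk with hk' | rfl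
    · rw [old _ _ hj', old _ _ hk']
      exact edge₂ j k hj' hk' hjk
    · rw [old _ _ hj', new] at h ⊢
      rwa [← hagree j hj' (.inl hjk)]
    · rw [old _ _ hk', new] at h ⊢
      rwa [← hagree k hk' (.inr hjk)]
    · simpa only [new] using h

end CEMRDir
end
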